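/- arXiv:2512.13964 — 3 statements merged into one kernel-verified Lean document; each statement's English description precedes it below -/
import Mathlib

section
/- Assume cᵢ ≥ 0 and ℓᵢ > 0 for i = 1,2,3, the ordering condition (Ω′), c₃/ℓ₃ < 1, and c₁/ℓ₁ + c₂/ℓ₂ + c₃/ℓ₃ < 1. Then Vol₄(P_H(c,ℓ)) = (32/3)·ℓ₁²ℓ₂²ℓ₃². -/
open MeasureTheory

/-- The convex hull of the graph of the trilinear monomial `x₁x₂x₃` over the box
`[c₁-ℓ₁, c₁+ℓ₁] × [c₂-ℓ₂, c₂+ℓ₂] × [c₃-ℓ₃, c₃+ℓ₃]`, viewed in `ℝ⁴`. -/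
noncomputable def PH (c₁ c₂ c₃ ℓ₁ ℓ₂ ℓ₃ : ℝ) : Set (Fin 4 → ℝ) :=
  convexHull ℝ {p : Fin 4 → ℝ | ∃ x₁ x₂ x₃ : ℝ,
    x₁ ∈ Set.Icc (c₁ - ℓ₁) (c₁ + ℓ₁) ∧ x₂ ∈ Set.Icc (c₂ - ℓ₂) (c₂ + ℓ₂) ∧
    x₃ ∈ Set.Icc (c₃ - ℓ₃) (c₃ + ℓ₃) ∧ p = ![x₁ * x₂ * x₃, x₁, x₂, x₃]}

/-- The graph over `[-1, 1]³` of `xyz + a yz + b xz + c xy`, which is the monomial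
`(x + a)(y + b)(z + c)` up to an affine function. -/
def cubeGraph (a b c : ℝ) : Set (Fin 4 → ℝ) :=
  {p | ∃ x ∈ Set.Icc (-1 : ℝ) 1, ∃ y ∈ Set.Icc (-1 : ℝ) 1, ∃ z ∈ Set.Icc (-1 : ℝ) 1,
    p = ![x * y * z + a * (y * z) + b * (x * z) + c * (x * y), x, y, z]}

/-- On `[-1, 1]³`, the piecewise linear function that is `1` at the vertex `(u, v, w)`, and `0`
outside the tetrahedron spanned by this vertex and its three neighbours. -/
noncomputable def cornerHat (u v w x y z : ℝ) : ℝ := max 0 ((u * x + v * y + w * z - 1) / 2)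

/-- The concave envelope over `[-1, 1]³` of `xyz + a yz + b xz + c xy`, provided that
`|a| + |b| + |c| ≤ 1`. -/
noncomputable def upperEnvelope (a b c x y z : ℝ) : ℝ :=
  1 + a * x + b * y + c * z
    - (2 - 2 * (a + b + c)) * cornerHat (-1) (-1) (-1) x y z
    - (2 + 2 * (b + c - a)) * cornerHat (-1) 1 1 x y z
    - (2 + 2 * (a + c - b)) * cornerHat 1 (-1) 1 x y z
    - (2 + 2 * (a + b - c)) * cornerHat 1 1 (-1) x y z

/-- The convex envelope over `[-1, 1]³` of `xyz + a yz + b xz + c xy`, provided that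
`|a| + |b| + |c| ≤ 1`. -/
noncomputable def lowerEnvelope (a b c x y z : ℝ) : ℝ :=
  -upperEnvelope (-a) (-b) (-c) (-x) (-y) (-z)

/-- The region between `lowerEnvelope` and `upperEnvelope` over `[-1, 1]³`. -/
def envelopeRegion (a b c : ℝ) : Set (Fin 4 → ℝ) :=
  {p | (p 1 ∈ Set.Icc (-1 : ℝ) 1 ∧ p 2 ∈ Set.Icc (-1 : ℝ) 1 ∧ p 3 ∈ Set.Icc (-1 : ℝ) 1) ∧
    p 0 ∈ Set.Icc (lowerEnvelope a b c (p 1) (p 2) (p 3)) (upperEnvelope a b c (p 1) (p 2) (p 3))}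

theorem Convex.add_four_mem {E : Type*} [AddCommGroup E] [Module ℝ E] {C : Set E}
    (hC : Convex ℝ C) {p q r s : E} (hp : p ∈ C) (hq : q ∈ C) (hr : r ∈ C) (hs : s ∈ C)
    {i j k l : ℝ} (hi : 0 ≤ i) (hj : 0 ≤ j) (hk : 0 ≤ k) (hl : 0 ≤ l) (h : i + j + k + l = 1) :
    i • p + j • q + k • r + l • s ∈ C := by
  have := hC.sum_mem (t := Finset.univ) (w := ![i, j, k, l]) (z := ![p, q, r, s])
    (by simp [Fin.forall_fin_succ, *]) (by simp [Fin.sum_univ_four, h])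
    (by simp [Fin.forall_fin_succ, *])
  simpa [Fin.sum_univ_four] using this

theorem mem_corner_of_cubeGraph_subset {a b c : ℝ} {C : Set (Fin 4 → ℝ)} (hC : Convex ℝ C)
    (hS : cubeGraph a b c ⊆ C) {u v w x y z : ℝ} (hu : u ^ 2 = 1) (hv : v ^ 2 = 1) (hw : w ^ 2 = 1)
    (hx : x ∈ Set.Icc (-1 : ℝ) 1) (hy : y ∈ Set.Icc (-1 : ℝ) 1) (hz : z ∈ Set.Icc (-1 : ℝ) 1)
    (h : 1 ≤ u * x + v * y + w * z) :
    ![(u * v * w + a * (v * w) + b * (u * w) + c * (u * v)) * ((u * x + v * y + w * z - 1) / 2)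
      + (-(u * v * w) + a * (v * w) - b * (u * w) - c * (u * v)) * ((1 - u * x) / 2)
      + (-(u * v * w) - a * (v * w) + b * (u * w) - c * (u * v)) * ((1 - v * y) / 2)
      + (-(u * v * w) - a * (v * w) - b * (u * w) + c * (u * v)) * ((1 - w * z) / 2),
      x, y, z] ∈ C := by
  have sgn : ∀ {s t : ℝ}, s ^ 2 = 1 → t ∈ Set.Icc (-1 : ℝ) 1 →
      s ∈ Set.Icc (-1 : ℝ) 1 ∧ -s ∈ Set.Icc (-1 : ℝ) 1 ∧ 0 ≤ (1 - s * t) / 2 := by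
    rintro s t hs ⟨h₁, h₂⟩
    rcases mul_self_eq_one_iff.mp ((sq s).symm.trans hs) with rfl | rfl <;> norm_num <;> linarith
  obtain ⟨hu₁, hu₂, hu₃⟩ := sgn hu hx
  obtain ⟨hv₁, hv₂, hv₃⟩ := sgn hv hy
  obtain ⟨hw₁, hw₂, hw₃⟩ := sgn hw hz
  convert hC.add_four_mem (hS ⟨u, hu₁, v, hv₁, w, hw₁, rfl⟩) (hS ⟨-u, hu₂, v, hv₁, w, hw₁, rfl⟩)
    (hS ⟨u, hu₁, -v, hv₂, w, hw₁, rfl⟩) (hS ⟨u, hu₁, v, hv₁, -w, hw₂, rfl⟩)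
    (i := (u * x + v * y + w * z - 1) / 2) (by linarith) hu₃ hv₃ hw₃ (by ring) using 1
  ext i
  fin_cases i
  · simp; ring
  · simp; linear_combination (-x) * hu
  · simp; linear_combination (-y) * hv
  · simp; linear_combination (-z) * hw

theorem upperEnvelope_mem {a b c : ℝ} {C : Set (Fin 4 → ℝ)} (hC : Convex ℝ C)
    (hS : cubeGraph a b c ⊆ C) {x y z : ℝ}
    (hx : x ∈ Set.Icc (-1 : ℝ) 1) (hy : y ∈ Set.Icc (-1 : ℝ) 1) (hz : z ∈ Set.Icc (-1 : ℝ) 1) :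
    ![upperEnvelope a b c x y z, x, y, z] ∈ C := by
  have ⟨hx₁, hx₂⟩ := hx
  have ⟨hy₁, hy₂⟩ := hy
  have ⟨hz₁, hz₂⟩ := hz
  have hat_pos : ∀ {u v w : ℝ}, 1 ≤ u * x + v * y + w * z →
      cornerHat u v w x y z = (u * x + v * y + w * z - 1) / 2 :=
    fun h => max_eq_right (by linarith)
  have hat_zero : ∀ {u v w : ℝ}, u * x + v * y + w * z ≤ 1 → cornerHat u v w x y z = 0 :=
    fun h => max_eq_left (by linarith)
  unfold upperEnvelope
  rcases le_total 1 ((-1) * x + (-1) * y + (-1) * z) with h₁ | h₁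
  · convert mem_corner_of_cubeGraph_subset hC hS (by norm_num) (by norm_num) (by norm_num)
      hx hy hz h₁ using 2
    rw [hat_pos h₁, hat_zero (by linarith), hat_zero (by linarith), hat_zero (by linarith)]
    ring
  rcases le_total 1 ((-1) * x + 1 * y + 1 * z) with h₂ | h₂
  · convert mem_corner_of_cubeGraph_subset hC hS (by norm_num) (by norm_num) (by norm_num)
      hx hy hz h₂ using 2
    rw [hat_zero h₁, hat_pos h₂, hat_zero (by linarith), hat_zero (by linarith)]
    ring
  rcases le_total 1 (1 * x + (-1) * y + 1 * z) with h₃ | h₃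
  · convert mem_corner_of_cubeGraph_subset hC hS (by norm_num) (by norm_num) (by norm_num)
      hx hy hz h₃ using 2
    rw [hat_zero h₁, hat_zero h₂, hat_pos h₃, hat_zero (by linarith)]
    ring
  rcases le_total 1 (1 * x + 1 * y + (-1) * z) with h₄ | h₄
  · convert mem_corner_of_cubeGraph_subset hC hS (by norm_num) (by norm_num) (by norm_num)
      hx hy hz h₄ using 2
    rw [hat_zero h₁, hat_zero h₂, hat_zero h₃, hat_pos h₄]
    ring
  rw [hat_zero h₁, hat_zero h₂, hat_zero h₃, hat_zero h₄]
  have one : (1 : ℝ) ∈ Set.Icc (-1 : ℝ) 1 := by norm_num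
  have neg_one : (-1 : ℝ) ∈ Set.Icc (-1 : ℝ) 1 := by norm_num
  convert hC.add_four_mem (hS ⟨1, one, 1, one, 1, one, rfl⟩)
    (hS ⟨1, one, -1, neg_one, -1, neg_one, rfl⟩) (hS ⟨-1, neg_one, 1, one, -1, neg_one, rfl⟩)
    (hS ⟨-1, neg_one, -1, neg_one, 1, one, rfl⟩)
    (i := (1 + x + y + z) / 4) (j := (1 + x - y - z) / 4) (k := (1 - x + y - z) / 4)
    (l := (1 - x - y + z) / 4)
    (by linarith) (by linarith) (by linarith) (by linarith) (by ring) using 1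
  ext i
  fin_cases i <;> simp <;> ring

theorem lowerEnvelope_mem {a b c : ℝ} {C : Set (Fin 4 → ℝ)} (hC : Convex ℝ C)
    (hS : cubeGraph a b c ⊆ C) {x y z : ℝ}
    (hx : x ∈ Set.Icc (-1 : ℝ) 1) (hy : y ∈ Set.Icc (-1 : ℝ) 1) (hz : z ∈ Set.Icc (-1 : ℝ) 1) :
    ![lowerEnvelope a b c x y z, x, y, z] ∈ C := by
  have neg_mem : ∀ {t : ℝ}, t ∈ Set.Icc (-1 : ℝ) 1 → -t ∈ Set.Icc (-1 : ℝ) 1 :=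
    fun h => ⟨by linarith [h.2], by linarith [h.1]⟩
  have h := upperEnvelope_mem (a := -a) (b := -b) (c := -c) hC.neg ?_
    (neg_mem hx) (neg_mem hy) (neg_mem hz)
  · simpa [lowerEnvelope] using h
  · rintro p ⟨x, hx, y, hy, z, hz, rfl⟩
    refine hS ⟨-x, neg_mem hx, -y, neg_mem hy, -z, neg_mem hz, ?_⟩
    ext i
    fin_cases i <;> simp
    ring

theorem envelopeRegion_subset_convexHull (a b c : ℝ) :
    envelopeRegion a b c ⊆ convexHull ℝ (cubeGraph a b c) := by
  rintro p ⟨⟨hx, hy, hz⟩, h⟩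
  have hC := convex_convexHull ℝ (cubeGraph a b c)
  have hu := upperEnvelope_mem hC (subset_convexHull ℝ _) hx hy hz
  have hl := lowerEnvelope_mem hC (subset_convexHull ℝ _) hx hy hz
  rw [← segment_eq_Icc (h.1.trans h.2)] at h
  obtain ⟨s, t, hs, ht, hst, h⟩ := h
  convert hC hl hu hs ht hst using 1
  ext i
  fin_cases i
  · simpa using h.symm
  all_goals simp [← add_mul, hst]

theorem cornerHat_combo_le (u v w : ℝ) {x y z x' y' z' s t : ℝ} (hs : 0 ≤ s) (ht : 0 ≤ t)
    (hst : s + t = 1) :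
    cornerHat u v w (s * x + t * x') (s * y + t * y') (s * z + t * z') ≤
      s * cornerHat u v w x y z + t * cornerHat u v w x' y' z' := by
  unfold cornerHat
  refine max_le (by positivity) ?_
  have h₁ := mul_le_mul_of_nonneg_left (le_max_right 0 ((u * x + v * y + w * z - 1) / 2)) hs
  have h₂ := mul_le_mul_of_nonneg_left (le_max_right 0 ((u * x' + v * y' + w * z' - 1) / 2)) ht
  linear_combination h₁ + h₂ + hst / 2

theorem combo_le_upperEnvelope {a b c : ℝ} (h : |a| + |b| + |c| ≤ 1) {x y z x' y' z' s t : ℝ}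
    (hs : 0 ≤ s) (ht : 0 ≤ t) (hst : s + t = 1) :
    s * upperEnvelope a b c x y z + t * upperEnvelope a b c x' y' z' ≤
      upperEnvelope a b c (s * x + t * x') (s * y + t * y') (s * z + t * z') := by
  have ha := abs_le.mp (le_refl |a|)
  have hb := abs_le.mp (le_refl |b|)
  have hc := abs_le.mp (le_refl |c|)
  have hat := fun u v w : ℝ => cornerHat_combo_le u v w (x := x) (y := y) (z := z)
    (x' := x') (y' := y') (z' := z') hs ht hst
  have h₁ := mul_le_mul_of_nonneg_left (hat (-1) (-1) (-1))
    (show 0 ≤ 2 - 2 * (a + b + c) by linarith)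
  have h₂ := mul_le_mul_of_nonneg_left (hat (-1) 1 1) (show 0 ≤ 2 + 2 * (b + c - a) by linarith)
  have h₃ := mul_le_mul_of_nonneg_left (hat 1 (-1) 1) (show 0 ≤ 2 + 2 * (a + c - b) by linarith)
  have h₄ := mul_le_mul_of_nonneg_left (hat 1 1 (-1)) (show 0 ≤ 2 + 2 * (a + b - c) by linarith)
  unfold upperEnvelope
  linear_combination h₁ + h₂ + h₃ + h₄ + hst

theorem convex_envelopeRegion {a b c : ℝ} (h : |a| + |b| + |c| ≤ 1) :
    Convex ℝ (envelopeRegion a b c) := by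
  rintro p ⟨⟨hp₁, hp₂, hp₃⟩, hpl, hpu⟩ q ⟨⟨hq₁, hq₂, hq₃⟩, hql, hqu⟩ s t hs ht hst
  refine ⟨⟨convex_Icc _ _ hp₁ hq₁ hs ht hst, convex_Icc _ _ hp₂ hq₂ hs ht hst,
    convex_Icc _ _ hp₃ hq₃ hs ht hst⟩, ?_, ?_⟩
  · have := combo_le_upperEnvelope (a := -a) (b := -b) (c := -c) (by simpa using h)
      (x := -p 1) (y := -p 2) (z := -p 3) (x' := -q 1) (y' := -q 2) (z' := -q 3) hs ht hst
    have e : ∀ i, s * -p i + t * -q i = -(s * p i + t * q i) := fun i => by ring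
    simp only [e] at this
    have h₁ := mul_le_mul_of_nonneg_left hpl hs
    have h₂ := mul_le_mul_of_nonneg_left hql ht
    simp only [lowerEnvelope, Pi.add_apply, Pi.smul_apply, smul_eq_mul] at h₁ h₂ ⊢
    linarith
  · have := combo_le_upperEnvelope h (x := p 1) (y := p 2) (z := p 3)
      (x' := q 1) (y' := q 2) (z' := q 3) hs ht hst
    have h₁ := mul_le_mul_of_nonneg_left hpu hs
    have h₂ := mul_le_mul_of_nonneg_left hqu ht
    simp only [Pi.add_apply, Pi.smul_apply, smul_eq_mul]
    linarith

theorem cubeGraph_subset_of_vertices {a b c : ℝ} {C : Set (Fin 4 → ℝ)} (hC : Convex ℝ C)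
    (hV : ∀ x y z : ℝ, x ∈ ({-1, 1} : Set ℝ) → y ∈ ({-1, 1} : Set ℝ) → z ∈ ({-1, 1} : Set ℝ) →
      ![x * y * z + a * (y * z) + b * (x * z) + c * (x * y), x, y, z] ∈ C) :
    cubeGraph a b c ⊆ C := by
  have combo : ∀ {p q r : Fin 4 → ℝ} {t : ℝ}, t ∈ Set.Icc (-1 : ℝ) 1 → p ∈ C → q ∈ C →
      r = ((1 - t) / 2) • p + ((1 + t) / 2) • q → r ∈ C := by
    rintro p q r t ⟨h₁, h₂⟩ hp hq rfl
    exact hC hp hq (by linarith) (by linarith) (by ring)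
  have neg : (-1 : ℝ) ∈ ({-1, 1} : Set ℝ) := by simp
  have pos : (1 : ℝ) ∈ ({-1, 1} : Set ℝ) := by simp
  rintro _ ⟨x, hx, y, hy, z, hz, rfl⟩
  have h₁ : ∀ x y : ℝ, x ∈ ({-1, 1} : Set ℝ) → y ∈ ({-1, 1} : Set ℝ) →
      ![x * y * z + a * (y * z) + b * (x * z) + c * (x * y), x, y, z] ∈ C := by
    intro x y hx hy
    refine combo hz (hV x y _ hx hy neg) (hV x y _ hx hy pos) ?_
    ext i
    fin_cases i <;> simp <;> ring
  have h₂ : ∀ x : ℝ, x ∈ ({-1, 1} : Set ℝ) →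
      ![x * y * z + a * (y * z) + b * (x * z) + c * (x * y), x, y, z] ∈ C := by
    intro x hx
    refine combo hy (h₁ x _ hx neg) (h₁ x _ hx pos) ?_
    ext i
    fin_cases i <;> simp <;> ring
  refine combo hx (h₂ _ neg) (h₂ _ pos) ?_
  ext i
  fin_cases i <;> simp <;> ring

theorem vertex_le_upperEnvelope (a b c : ℝ) {x y z : ℝ}
    (hx : x ∈ ({-1, 1} : Set ℝ)) (hy : y ∈ ({-1, 1} : Set ℝ)) (hz : z ∈ ({-1, 1} : Set ℝ)) :
    x * y * z + a * (y * z) + b * (x * z) + c * (x * y) ≤ upperEnvelope a b c x y z := by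
  unfold upperEnvelope cornerHat
  rcases hx with rfl | rfl <;> rcases hy with rfl | rfl <;> rcases hz with rfl | rfl <;>
    norm_num <;> linarith

theorem convexHull_cubeGraph {a b c : ℝ} (h : |a| + |b| + |c| ≤ 1) :
    convexHull ℝ (cubeGraph a b c) = envelopeRegion a b c := by
  refine (convexHull_min ?_ (convex_envelopeRegion h)).antisymm
    (envelopeRegion_subset_convexHull a b c)
  refine cubeGraph_subset_of_vertices (convex_envelopeRegion h) fun x y z hx hy hz => ?_
  have mem : ∀ {t : ℝ}, t ∈ ({-1, 1} : Set ℝ) → t ∈ Set.Icc (-1 : ℝ) 1 := by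
    rintro t (rfl | rfl) <;> norm_num
  have neg_mem : ∀ {t : ℝ}, t ∈ ({-1, 1} : Set ℝ) → -t ∈ ({-1, 1} : Set ℝ) := by
    rintro t (rfl | rfl) <;> norm_num
  refine ⟨⟨mem hx, mem hy, mem hz⟩, ?_, vertex_le_upperEnvelope a b c hx hy hz⟩
  have := vertex_le_upperEnvelope (-a) (-b) (-c) (neg_mem hx) (neg_mem hy) (neg_mem hz)
  simp only [lowerEnvelope, Matrix.cons_val]
  linarith

theorem integral_max_zero_pow {n : ℕ} (hn : n ≠ 0) (r s : ℝ) :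
    ∫ t in r..s, max 0 t ^ n = (max 0 s ^ (n + 1) - max 0 r ^ (n + 1)) / (n + 1) := by
  have key := integral_eq_of_hasDerivAt_off_countable (fun t : ℝ => max 0 t ^ (n + 1) / (n + 1))
    (fun t => max 0 t ^ n) (a := r) (b := s) (Set.countable_singleton 0)
    (by fun_prop) (fun t ht => ?_) (Continuous.intervalIntegrable (by fun_prop) _ _)
  · rw [key, sub_div]
  · rcases lt_or_gt_of_ne (show t ≠ 0 from ht.2) with h | h
    · refine ((hasDerivAt_const t (0 : ℝ)).congr_of_eventuallyEq ?_).congr_deriv ?_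
      · filter_upwards [gt_mem_nhds h] with u hu
        simp [max_eq_left hu.le]
      · simp [max_eq_left h.le, hn]
    · refine (((hasDerivAt_pow (n + 1) t).div_const ((n : ℝ) + 1)).congr_of_eventuallyEq
        ?_).congr_deriv ?_
      · filter_upwards [lt_mem_nhds h] with u hu
        simp [max_eq_right hu.le]
      · rw [max_eq_right h.le]
        have : (n : ℝ) + 1 ≠ 0 := by positivity
        push_cast
        field_simp

theorem setIntegral_cube {F : ℝ × ℝ × ℝ → ℝ} (hF : Continuous F) :
    ∫ t in Set.Icc (-1 : ℝ) 1 ×ˢ Set.Icc (-1 : ℝ) 1 ×ˢ Set.Icc (-1 : ℝ) 1, F t =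
      ∫ x in (-1 : ℝ)..1, ∫ y in (-1 : ℝ)..1, ∫ z in (-1 : ℝ)..1, F (x, y, z) := by
  have h₁ : (-1 : ℝ) ≤ 1 := by norm_num
  have hI : IsCompact (Set.Icc (-1 : ℝ) 1) := isCompact_Icc
  simp only [intervalIntegral.integral_of_le h₁, ← integral_Icc_eq_integral_Ioc]
  rw [Measure.volume_eq_prod,
    setIntegral_prod _ (hF.continuousOn.integrableOn_compact (hI.prod (hI.prod hI)))]
  congr 1
  ext x
  rw [Measure.volume_eq_prod, setIntegral_prod]
  exact (Continuous.continuousOn (by fun_prop)).integrableOn_compact (hI.prod hI)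

theorem integral_sign_mul (g : ℝ → ℝ) {s : ℝ} (hs : s ^ 2 = 1) :
    ∫ t in (-1 : ℝ)..1, g (s * t) = ∫ t in (-1 : ℝ)..1, g t := by
  rcases mul_self_eq_one_iff.mp ((sq s).symm.trans hs) with rfl | rfl
  · simp
  · simp [intervalIntegral.integral_comp_neg]

theorem integral_cornerHat {u v w : ℝ} (hu : u ^ 2 = 1) (hv : v ^ 2 = 1) (hw : w ^ 2 = 1) :
    ∫ x in (-1 : ℝ)..1, ∫ y in (-1 : ℝ)..1, ∫ z in (-1 : ℝ)..1, cornerHat u v w x y z = 1 / 3 := by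
  have inner : ∀ r ∈ Set.Icc (-2 : ℝ) 2,
      ∫ z in (-1 : ℝ)..1, max 0 ((r + z - 1) / 2) = max 0 r ^ 2 / 4 := by
    intro r hr
    have e : ∀ z : ℝ, max 0 ((r + z - 1) / 2) = max 0 ((r - 1) + z) ^ 1 / 2 := by
      intro z
      rw [pow_one, ← max_div_div_right zero_le_two, zero_div, add_sub_right_comm]
    simp only [e, intervalIntegral.integral_div]
    rw [intervalIntegral.integral_comp_add_left (fun z => max 0 z ^ 1) (r - 1),
      integral_max_zero_pow one_ne_zero, max_eq_left (show r - 1 + -1 ≤ 0 by linarith [hr.2])]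
    norm_num
    ring
  have middle : ∀ x ∈ Set.Icc (-1 : ℝ) 1,
      ∫ y in (-1 : ℝ)..1, max 0 (x + y) ^ 2 / 4 = max 0 (1 + x) ^ 3 / 12 := by
    intro x hx
    rw [intervalIntegral.integral_div,
      intervalIntegral.integral_comp_add_left (fun z => max 0 z ^ 2) x,
      integral_max_zero_pow two_ne_zero, max_eq_left (show x + -1 ≤ 0 by linarith [hx.2])]
    norm_num
    ring_nf
  have Icc_of_uIcc : ∀ {t : ℝ}, t ∈ Set.uIcc (-1 : ℝ) 1 → t ∈ Set.Icc (-1 : ℝ) 1 := by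
    intro t ht
    rwa [Set.uIcc_of_le (by norm_num)] at ht
  unfold cornerHat
  rw [integral_sign_mul (fun x => ∫ y in (-1 : ℝ)..1, ∫ z in (-1 : ℝ)..1,
    max 0 ((x + v * y + w * z - 1) / 2)) hu]
  rw [show (1 / 3 : ℝ) = ∫ x in (-1 : ℝ)..1, max 0 (1 + x) ^ 3 / 12 by
    rw [intervalIntegral.integral_div,
      intervalIntegral.integral_comp_add_left (fun z => max 0 z ^ 3) 1,
      integral_max_zero_pow three_ne_zero]
    norm_num]
  refine intervalIntegral.integral_congr fun x hx => ?_
  rw [integral_sign_mul (fun y => ∫ z in (-1 : ℝ)..1, max 0 ((x + y + w * z - 1) / 2)) hv,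
    ← middle x (Icc_of_uIcc hx)]
  refine intervalIntegral.integral_congr fun y hy => ?_
  rw [integral_sign_mul (fun z => max 0 ((x + y + z - 1) / 2)) hw]
  have hx := Icc_of_uIcc hx
  have hy := Icc_of_uIcc hy
  exact inner _ ⟨by linarith [hx.1, hy.1], by linarith [hx.2, hy.2]⟩

@[fun_prop]
theorem continuous_cornerHat (u v w : ℝ) :
    Continuous fun t : ℝ × ℝ × ℝ => cornerHat u v w t.1 t.2.1 t.2.2 := by
  unfold cornerHat
  fun_prop

theorem continuous_upperEnvelope (a b c : ℝ) :
    Continuous fun t : ℝ × ℝ × ℝ => upperEnvelope a b c t.1 t.2.1 t.2.2 := by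
  unfold upperEnvelope
  fun_prop

theorem continuous_lowerEnvelope (a b c : ℝ) :
    Continuous fun t : ℝ × ℝ × ℝ => lowerEnvelope a b c t.1 t.2.1 t.2.2 :=
  ((continuous_upperEnvelope (-a) (-b) (-c)).comp continuous_neg).neg

theorem integral_upperEnvelope (a b c : ℝ) :
    ∫ t in Set.Icc (-1 : ℝ) 1 ×ˢ Set.Icc (-1 : ℝ) 1 ×ˢ Set.Icc (-1 : ℝ) 1,
      upperEnvelope a b c t.1 t.2.1 t.2.2 = 16 / 3 := by
  have hI : IsCompact (Set.Icc (-1 : ℝ) 1) := isCompact_Icc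
  have int : ∀ {F : ℝ × ℝ × ℝ → ℝ}, Continuous F → Integrable F (volume.restrict
      (Set.Icc (-1 : ℝ) 1 ×ˢ Set.Icc (-1 : ℝ) 1 ×ˢ Set.Icc (-1 : ℝ) 1)) :=
    fun hF => hF.continuousOn.integrableOn_compact (hI.prod (hI.prod hI))
  have hat : ∀ {u v w : ℝ}, u ^ 2 = 1 → v ^ 2 = 1 → w ^ 2 = 1 →
      ∫ t in Set.Icc (-1 : ℝ) 1 ×ˢ Set.Icc (-1 : ℝ) 1 ×ˢ Set.Icc (-1 : ℝ) 1,
        cornerHat u v w t.1 t.2.1 t.2.2 = 1 / 3 := fun hu hv hw => by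
    rw [setIntegral_cube (continuous_cornerHat _ _ _), integral_cornerHat hu hv hw]
  have affine : ∫ t in Set.Icc (-1 : ℝ) 1 ×ˢ Set.Icc (-1 : ℝ) 1 ×ˢ Set.Icc (-1 : ℝ) 1,
      (1 + a * t.1 + b * t.2.1 + c * t.2.2) = 8 := by
    rw [setIntegral_cube (by fun_prop)]
    have inner : ∀ r s : ℝ, ∫ z in (-1 : ℝ)..1, (r + s * z) = 2 * r := by
      intro r s
      rw [intervalIntegral.integral_add (by simp)
        (Continuous.intervalIntegrable (by fun_prop) _ _),
        intervalIntegral.integral_const_mul, integral_id, intervalIntegral.integral_const]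
      norm_num
    simp only [inner, intervalIntegral.integral_const_mul]
    norm_num
  unfold upperEnvelope
  rw [integral_sub (int (by fun_prop)) (int (by fun_prop)),
    integral_sub (int (by fun_prop)) (int (by fun_prop)),
    integral_sub (int (by fun_prop)) (int (by fun_prop)),
    integral_sub (int (by fun_prop)) (int (by fun_prop)), affine]
  simp only [integral_const_mul]
  rw [hat, hat, hat, hat]
  · ring
  all_goals norm_num

theorem integral_lowerEnvelope (a b c : ℝ) :
    ∫ t in Set.Icc (-1 : ℝ) 1 ×ˢ Set.Icc (-1 : ℝ) 1 ×ˢ Set.Icc (-1 : ℝ) 1,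
      lowerEnvelope a b c t.1 t.2.1 t.2.2 = -(16 / 3) := by
  have h := integral_upperEnvelope (-a) (-b) (-c)
  have refl : ∀ g : ℝ → ℝ, ∫ t in (-1 : ℝ)..1, g (-t) = ∫ t in (-1 : ℝ)..1, g t := fun g => by
    simp [intervalIntegral.integral_comp_neg]
  rw [setIntegral_cube (continuous_upperEnvelope _ _ _)] at h
  rw [setIntegral_cube (continuous_lowerEnvelope _ _ _), ← h]
  simp only [lowerEnvelope, intervalIntegral.integral_neg]
  rw [refl fun x => ∫ y in (-1 : ℝ)..1, ∫ z in (-1 : ℝ)..1,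
    upperEnvelope (-a) (-b) (-c) x (-y) (-z)]
  congr 1
  refine intervalIntegral.integral_congr fun x _ => ?_
  rw [refl fun y => ∫ z in (-1 : ℝ)..1, upperEnvelope (-a) (-b) (-c) x y (-z)]
  refine intervalIntegral.integral_congr fun y _ => ?_
  exact refl fun z => upperEnvelope (-a) (-b) (-c) x y z

theorem volume_preserving_vecCons :
    MeasurePreserving (fun q : ℝ × ℝ × ℝ × ℝ => ![q.1, q.2.1, q.2.2.1, q.2.2.2])
      volume volume := by
  have cons : ∀ n : ℕ, MeasurePreserving
      (fun q : ℝ × (Fin n → ℝ) => (Fin.cons q.1 q.2 : Fin (n + 1) → ℝ)) volume volume := by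
    intro n
    have e : ⇑(MeasurableEquiv.piFinSuccAbove (fun _ : Fin (n + 1) => ℝ) 0).symm =
        fun q => Fin.cons q.1 q.2 := funext fun q => Fin.insertNth_zero' q.1 q.2
    exact e ▸ (volume_preserving_piFinSuccAbove (fun _ : Fin (n + 1) => ℝ) 0).symm
  have id := MeasurePreserving.id (volume : Measure ℝ)
  have one := (volume_preserving_funUnique (Fin 1) ℝ).symm
  have h := (cons 3).comp (id.prod ((cons 2).comp (id.prod ((cons 1).comp (id.prod one)))))
  refine (congrArg (MeasurePreserving · volume volume) ?_).mpr h
  exact funext fun q => funext fun i => by fin_cases i <;> rfl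

theorem volume_envelopeRegion {a b c : ℝ}
    (h : ∀ x ∈ Set.Icc (-1 : ℝ) 1, ∀ y ∈ Set.Icc (-1 : ℝ) 1, ∀ z ∈ Set.Icc (-1 : ℝ) 1,
      lowerEnvelope a b c x y z ≤ upperEnvelope a b c x y z) :
    volume (envelopeRegion a b c) = ENNReal.ofReal (32 / 3) := by
  have hI : IsCompact (Set.Icc (-1 : ℝ) 1) := isCompact_Icc
  have hQ := hI.prod (hI.prod hI)
  have hu := continuous_upperEnvelope a b c
  have hl := continuous_lowerEnvelope a b c
  have hmeas : MeasurableSet {q : ℝ × ℝ × ℝ × ℝ |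
      q.2 ∈ Set.Icc (-1 : ℝ) 1 ×ˢ Set.Icc (-1 : ℝ) 1 ×ˢ Set.Icc (-1 : ℝ) 1 ∧
      lowerEnvelope a b c q.2.1 q.2.2.1 q.2.2.2 ≤ q.1 ∧
      q.1 ≤ upperEnvelope a b c q.2.1 q.2.2.1 q.2.2.2} :=
    (hQ.isClosed.preimage continuous_snd).inter ((isClosed_le (hl.comp continuous_snd)
      continuous_fst).inter (isClosed_le continuous_fst (hu.comp continuous_snd)))
      |>.measurableSet
  have hregion : IsClosed (envelopeRegion a b c) := by
    have hproj : Continuous fun p : Fin 4 → ℝ => (p 1, p 2, p 3) := by fun_prop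
    exact (hQ.isClosed.preimage hproj).inter ((isClosed_le (hl.comp hproj)
      (continuous_apply 0)).inter (isClosed_le (continuous_apply 0) (hu.comp hproj)))
  rw [← volume_preserving_vecCons.measure_preimage hregion.measurableSet.nullMeasurableSet]
  change volume {q : ℝ × ℝ × ℝ × ℝ |
      q.2 ∈ Set.Icc (-1 : ℝ) 1 ×ˢ Set.Icc (-1 : ℝ) 1 ×ˢ Set.Icc (-1 : ℝ) 1 ∧
      lowerEnvelope a b c q.2.1 q.2.2.1 q.2.2.2 ≤ q.1 ∧
      q.1 ≤ upperEnvelope a b c q.2.1 q.2.2.1 q.2.2.2} = _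
  rw [Measure.volume_eq_prod, Measure.prod_apply_symm hmeas]
  have hslice : ∀ t : ℝ × ℝ × ℝ, volume ((fun y : ℝ => (y, t)) ⁻¹' {q : ℝ × ℝ × ℝ × ℝ |
      q.2 ∈ Set.Icc (-1 : ℝ) 1 ×ˢ Set.Icc (-1 : ℝ) 1 ×ˢ Set.Icc (-1 : ℝ) 1 ∧
      lowerEnvelope a b c q.2.1 q.2.2.1 q.2.2.2 ≤ q.1 ∧
      q.1 ≤ upperEnvelope a b c q.2.1 q.2.2.1 q.2.2.2}) =
      (Set.Icc (-1 : ℝ) 1 ×ˢ Set.Icc (-1 : ℝ) 1 ×ˢ Set.Icc (-1 : ℝ) 1).indicator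
        (fun t => ENNReal.ofReal (upperEnvelope a b c t.1 t.2.1 t.2.2 -
          lowerEnvelope a b c t.1 t.2.1 t.2.2)) t := by
    intro t
    by_cases ht : t ∈ Set.Icc (-1 : ℝ) 1 ×ˢ Set.Icc (-1 : ℝ) 1 ×ˢ Set.Icc (-1 : ℝ) 1
    · rw [Set.indicator_of_mem ht, ← Real.volume_Icc]
      congr 1
      ext y
      exact and_iff_right ht
    · rw [Set.indicator_of_notMem ht, ← measure_empty (μ := (volume : Measure ℝ))]
      congr 1
      ext y
      exact iff_of_false (fun hy => ht hy.1) (Set.notMem_empty y)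
  simp only [hslice]
  rw [lintegral_indicator hQ.isClosed.measurableSet, ← ofReal_integral_eq_lintegral_ofReal,
    integral_sub, integral_upperEnvelope, integral_lowerEnvelope]
  · norm_num
  · exact hu.continuousOn.integrableOn_compact hQ
  · exact hl.continuousOn.integrableOn_compact hQ
  · exact (hu.sub hl).continuousOn.integrableOn_compact hQ
  · filter_upwards [ae_restrict_mem hQ.isClosed.measurableSet] with t ht
    exact sub_nonneg.mpr (h _ ht.1 _ ht.2.1 _ ht.2.2)

theorem lowerEnvelope_le_upperEnvelope {a b c : ℝ} (h : |a| + |b| + |c| ≤ 1) {x y z : ℝ}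
    (hx : x ∈ Set.Icc (-1 : ℝ) 1) (hy : y ∈ Set.Icc (-1 : ℝ) 1) (hz : z ∈ Set.Icc (-1 : ℝ) 1) :
    lowerEnvelope a b c x y z ≤ upperEnvelope a b c x y z := by
  have hmem := subset_convexHull ℝ (cubeGraph a b c) ⟨x, hx, y, hy, z, hz, rfl⟩
  rw [convexHull_cubeGraph h] at hmem
  exact hmem.2.1.trans hmem.2.2

/-- The linear part of the affine map taking the normalized graph over `[-1, 1]³` to the graph of
`x₁x₂x₃` over the box with centre `(c₁, c₂, c₃)` and half side lengths `ℓ₁, ℓ₂, ℓ₃`. -/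
def boxMatrix (c₁ c₂ c₃ ℓ₁ ℓ₂ ℓ₃ : ℝ) : Matrix (Fin 4) (Fin 4) ℝ :=
  !![ℓ₁ * ℓ₂ * ℓ₃, c₂ * c₃ * ℓ₁, c₁ * c₃ * ℓ₂, c₁ * c₂ * ℓ₃;
    0, ℓ₁, 0, 0;
    0, 0, ℓ₂, 0;
    0, 0, 0, ℓ₃]

theorem det_boxMatrix (c₁ c₂ c₃ ℓ₁ ℓ₂ ℓ₃ : ℝ) :
    (boxMatrix c₁ c₂ c₃ ℓ₁ ℓ₂ ℓ₃).det = ℓ₁ ^ 2 * ℓ₂ ^ 2 * ℓ₃ ^ 2 := by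
  have h : (boxMatrix c₁ c₂ c₃ ℓ₁ ℓ₂ ℓ₃).IsUpperTriangular := by
    intro i j hij
    fin_cases i <;> fin_cases j <;> first | rfl | exact absurd hij (by decide)
  rw [Matrix.det_of_isUpperTriangular h, Fin.prod_univ_four]
  simp [boxMatrix]
  ring

open scoped Pointwise in
theorem PH_eq_vadd_image {c₁ c₂ c₃ ℓ₁ ℓ₂ ℓ₃ : ℝ} (hℓ₁ : 0 < ℓ₁) (hℓ₂ : 0 < ℓ₂) (hℓ₃ : 0 < ℓ₃) :
    PH c₁ c₂ c₃ ℓ₁ ℓ₂ ℓ₃ = ![c₁ * c₂ * c₃, c₁, c₂, c₃] +ᵥ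
      Matrix.toLin' (boxMatrix c₁ c₂ c₃ ℓ₁ ℓ₂ ℓ₃) ''
        convexHull ℝ (cubeGraph (c₁ / ℓ₁) (c₂ / ℓ₂) (c₃ / ℓ₃)) := by
  have point : ∀ x y z : ℝ, ![c₁ * c₂ * c₃, c₁, c₂, c₃] +
      Matrix.toLin' (boxMatrix c₁ c₂ c₃ ℓ₁ ℓ₂ ℓ₃) ![x * y * z + c₁ / ℓ₁ * (y * z) +
        c₂ / ℓ₂ * (x * z) + c₃ / ℓ₃ * (x * y), x, y, z] =
      ![(c₁ + ℓ₁ * x) * (c₂ + ℓ₂ * y) * (c₃ + ℓ₃ * z), c₁ + ℓ₁ * x, c₂ + ℓ₂ * y, c₃ + ℓ₃ * z] := by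
    intro x y z
    ext i
    fin_cases i <;> simp [boxMatrix] <;> field_simp
    ring
  have scale : ∀ {c ℓ t : ℝ}, 0 < ℓ → t ∈ Set.Icc (c - ℓ) (c + ℓ) →
      ∃ s ∈ Set.Icc (-1 : ℝ) 1, c + ℓ * s = t := by
    rintro c ℓ t hℓ ⟨h₁, h₂⟩
    refine ⟨(t - c) / ℓ, ⟨?_, ?_⟩, ?_⟩
    · rw [le_div_iff₀ hℓ]; linarith
    · rw [div_le_iff₀ hℓ]; linarith
    · field_simp; ring
  have unscale : ∀ {c ℓ s : ℝ}, 0 < ℓ → s ∈ Set.Icc (-1 : ℝ) 1 →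
      c + ℓ * s ∈ Set.Icc (c - ℓ) (c + ℓ) := by
    rintro c ℓ s hℓ ⟨h₁, h₂⟩
    constructor <;> nlinarith
  rw [LinearMap.image_convexHull, ← convexHull_vadd, PH]
  congr 1
  ext p
  simp only [Set.mem_vadd_set, Set.mem_image, vadd_eq_add]
  constructor
  · rintro ⟨x₁, x₂, x₃, h₁, h₂, h₃, rfl⟩
    obtain ⟨x, hx, rfl⟩ := scale hℓ₁ h₁
    obtain ⟨y, hy, rfl⟩ := scale hℓ₂ h₂
    obtain ⟨z, hz, rfl⟩ := scale hℓ₃ h₃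
    exact ⟨_, ⟨_, ⟨x, hx, y, hy, z, hz, rfl⟩, rfl⟩, point x y z⟩
  · rintro ⟨_, ⟨_, ⟨x, hx, y, hy, z, hz, rfl⟩, rfl⟩, rfl⟩
    exact ⟨_, _, _, unscale hℓ₁ hx, unscale hℓ₂ hy, unscale hℓ₃ hz, point x y z⟩

theorem volume_PH_case6 (c₁ c₂ c₃ ℓ₁ ℓ₂ ℓ₃ : ℝ)
    (hc₁ : 0 ≤ c₁) (hc₂ : 0 ≤ c₂) (hc₃ : 0 ≤ c₃)
    (hℓ₁ : 0 < ℓ₁) (hℓ₂ : 0 < ℓ₂) (hℓ₃ : 0 < ℓ₃)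
    (hΩ₁ : c₁ / ℓ₁ ≤ c₂ / ℓ₂) (hΩ₂ : c₂ / ℓ₂ ≤ c₃ / ℓ₃)
    (h₁ : c₃ / ℓ₃ < 1) (h₂ : c₁ / ℓ₁ + c₂ / ℓ₂ + c₃ / ℓ₃ < 1) :
    volume (PH c₁ c₂ c₃ ℓ₁ ℓ₂ ℓ₃) =
      ENNReal.ofReal (32 / 3 * ℓ₁ ^ 2 * ℓ₂ ^ 2 * ℓ₃ ^ 2) := by
  have habs : |c₁ / ℓ₁| + |c₂ / ℓ₂| + |c₃ / ℓ₃| ≤ 1 := by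
    rw [abs_of_nonneg (by positivity), abs_of_nonneg (by positivity),
      abs_of_nonneg (by positivity)]
    exact h₂.le
  rw [PH_eq_vadd_image hℓ₁ hℓ₂ hℓ₃, measure_vadd, Measure.addHaar_image_linearMap,
    LinearMap.det_toLin', det_boxMatrix, convexHull_cubeGraph habs,
    volume_envelopeRegion fun _ hx _ hy _ hz => lowerEnvelope_le_upperEnvelope habs hx hy hz,
    ← ENNReal.ofReal_mul (abs_nonneg _), abs_of_nonneg (by positivity)]
  ring_nf
end

section
/- Assume cᵢ ≥ 0 and ℓᵢ > 0 for i = 1,2,3. Then the 3-dimensional Lebesgue volume of R′ equals (8/3)·ℓ₁²ℓ₂²·(c₃ + ℓ₃). -/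
open MeasureTheory

/-- The cross-section `Q'` of the hull of the graph of `x₁x₂x₃` at `x₃ = c₃ - ℓ₃`,
in the `(f, x₁, x₂)` coordinates of `ℝ³`. -/
noncomputable def Qset (c₁ c₂ c₃ ℓ₁ ℓ₂ ℓ₃ : ℝ) : Set (Fin 3 → ℝ) :=
  convexHull ℝ
    ({![(c₁ - ℓ₁) * (c₂ - ℓ₂) * (c₃ - ℓ₃), c₁ - ℓ₁, c₂ - ℓ₂],
      ![(c₁ + ℓ₁) * (c₂ - ℓ₂) * (c₃ - ℓ₃), c₁ + ℓ₁, c₂ - ℓ₂],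
      ![(c₁ - ℓ₁) * (c₂ + ℓ₂) * (c₃ - ℓ₃), c₁ - ℓ₁, c₂ + ℓ₂],
      ![(c₁ + ℓ₁) * (c₂ + ℓ₂) * (c₃ - ℓ₃), c₁ + ℓ₁, c₂ + ℓ₂]} : Set (Fin 3 → ℝ))

/-- The cross-section `R'` of the hull of the graph of `x₁x₂x₃` at `x₃ = c₃ + ℓ₃`,
in the `(f, x₁, x₂)` coordinates of `ℝ³`. -/
noncomputable def Rset (c₁ c₂ c₃ ℓ₁ ℓ₂ ℓ₃ : ℝ) : Set (Fin 3 → ℝ) :=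
  convexHull ℝ
    ({![(c₁ - ℓ₁) * (c₂ - ℓ₂) * (c₃ + ℓ₃), c₁ - ℓ₁, c₂ - ℓ₂],
      ![(c₁ + ℓ₁) * (c₂ - ℓ₂) * (c₃ + ℓ₃), c₁ + ℓ₁, c₂ - ℓ₂],
      ![(c₁ - ℓ₁) * (c₂ + ℓ₂) * (c₃ + ℓ₃), c₁ - ℓ₁, c₂ + ℓ₂],
      ![(c₁ + ℓ₁) * (c₂ + ℓ₂) * (c₃ + ℓ₃), c₁ + ℓ₁, c₂ + ℓ₂]} : Set (Fin 3 → ℝ))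

theorem volume_setOf_nonneg_sum_le (n : ℕ) {t : ℝ} (ht : 0 ≤ t) :
    volume {x : Fin n → ℝ | (∀ i, 0 ≤ x i) ∧ ∑ i, x i ≤ t} =
      ENNReal.ofReal (t ^ n / n.factorial) := by
  induction n generalizing t with
  | zero => simp [ht, volume_pi]
  | succ n ih =>
    have hmeas : MeasurableSet
        {p : ℝ × (Fin n → ℝ) | (0 ≤ p.1 ∧ ∀ i, 0 ≤ p.2 i) ∧ p.1 + ∑ i, p.2 i ≤ t} := by
      refine IsClosed.measurableSet ?_
      simp only [Set.ofPred_and, Set.ofPred_forall]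
      refine ((isClosed_le (by fun_prop) (by fun_prop)).inter
        (isClosed_iInter fun i => isClosed_le (by fun_prop) (by fun_prop))).inter
        (isClosed_le (by fun_prop) (by fun_prop))
    have hpre : {x : Fin (n + 1) → ℝ | (∀ i, 0 ≤ x i) ∧ ∑ i, x i ≤ t} =
        MeasurableEquiv.piFinSuccAbove (fun _ => ℝ) 0 ⁻¹'
          {p : ℝ × (Fin n → ℝ) | (0 ≤ p.1 ∧ ∀ i, 0 ≤ p.2 i) ∧ p.1 + ∑ i, p.2 i ≤ t} := by
      ext x
      simp [MeasurableEquiv.piFinSuccAbove, Fin.forall_fin_succ, Fin.sum_univ_succ, Fin.tail]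
    have hsection (s : ℝ) :
        volume (Prod.mk s ⁻¹'
          {p : ℝ × (Fin n → ℝ) | (0 ≤ p.1 ∧ ∀ i, 0 ≤ p.2 i) ∧ p.1 + ∑ i, p.2 i ≤ t}) =
        (Set.Icc 0 t).indicator (fun s => ENNReal.ofReal ((t - s) ^ n / n.factorial)) s := by
      by_cases hs : s ∈ Set.Icc 0 t
      · rw [Set.indicator_of_mem hs, ← ih (sub_nonneg.2 hs.2)]
        congr 1
        ext y
        simp [hs.1, le_sub_iff_add_le']
      · rw [Set.indicator_of_notMem hs]
        convert measure_empty (μ := (volume : Measure (Fin n → ℝ)))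
        refine Set.eq_empty_of_forall_notMem fun y hy => hs ⟨hy.1.1, ?_⟩
        have := Finset.sum_nonneg fun i (_ : i ∈ Finset.univ) => hy.1.2 i
        have := hy.2
        dsimp at *
        linarith
    rw [hpre, (volume_preserving_piFinSuccAbove (fun _ => ℝ) 0).measure_preimage_equiv,
      Measure.volume_eq_prod, Measure.prod_apply hmeas]
    simp only [hsection]
    rw [lintegral_indicator measurableSet_Icc, ← ofReal_integral_eq_lintegral_ofReal]
    · rw [integral_Icc_eq_integral_Ioc, ← intervalIntegral.integral_of_le ht,
        intervalIntegral.integral_div,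
        intervalIntegral.integral_comp_sub_left (fun x => x ^ n), integral_pow]
      congr 1
      rw [Nat.factorial_succ]
      push_cast
      field_simp
      simp
    · exact (Continuous.integrableOn_Icc (by fun_prop))
    · refine (ae_restrict_iff' measurableSet_Icc).2 (Filter.Eventually.of_forall fun s hs => ?_)
      have := sub_nonneg.2 hs.2
      dsimp
      positivity

theorem convexHull_insert_zero_range_single (n : ℕ) :
    convexHull ℝ (insert 0 (Set.range fun i : Fin n => (Pi.single i 1 : Fin n → ℝ))) =
      {x | (∀ i, 0 ≤ x i) ∧ ∑ i, x i ≤ 1} := by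
  refine Set.Subset.antisymm (convexHull_min ?_ ?_) fun x hx => ?_
  · rintro _ (rfl | ⟨i, rfl⟩)
    · simp
    · refine ⟨fun j => ?_, by simp⟩
      by_cases h : j = i <;> simp [h]
  · rintro x ⟨hx, hx'⟩ y ⟨hy, hy'⟩ a b ha hb hab
    refine ⟨fun i => add_nonneg (mul_nonneg ha (hx i)) (mul_nonneg hb (hy i)), ?_⟩
    simp only [Pi.add_apply, Pi.smul_apply, smul_eq_mul, Finset.sum_add_distrib,
      ← Finset.mul_sum]
    nlinarith
  · refine mem_convexHull_of_exists_fintype (ι := Option (Fin n))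
      (fun o => o.elim (1 - ∑ i, x i) x) (fun o => o.elim 0 fun i => Pi.single i 1) ?_ ?_ ?_ ?_
    · rintro (_ | i)
      · exact sub_nonneg.2 hx.2
      · exact hx.1 i
    · simp
    · rintro (_ | i) <;> simp
    · ext j
      simp [Pi.single_apply]

open scoped Pointwise in
theorem volume_convexHull_simplex {n : ℕ} (p : Fin n → ℝ) (v : Matrix (Fin n) (Fin n) ℝ) :
    volume (convexHull ℝ (insert p (Set.range fun i => p + v i))) =
      ENNReal.ofReal (|v.det| / n.factorial) := by
  have himage : insert p (Set.range fun i => p + v i) =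
      p +ᵥ v.transpose.toLin' ''
        insert 0 (Set.range fun i : Fin n => (Pi.single i 1 : Fin n → ℝ)) := by
    rw [Set.image_insert_eq, ← Set.range_comp, Set.vadd_set_insert, map_zero, vadd_eq_add,
      add_zero, Set.vadd_set_range]
    congr! 3
    ext
    simp
  rw [himage, convexHull_vadd, ← LinearMap.image_convexHull, convexHull_insert_zero_range_single,
    measure_vadd, Measure.addHaar_image_linearMap, volume_setOf_nonneg_sum_le n zero_le_one,
    LinearMap.det_toLin', Matrix.det_transpose, ← ENNReal.ofReal_mul (abs_nonneg _)]
  simp [div_eq_mul_inv]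

theorem volume_Rset (c₁ c₂ c₃ ℓ₁ ℓ₂ ℓ₃ : ℝ)
    (hc₁ : 0 ≤ c₁) (hc₂ : 0 ≤ c₂) (hc₃ : 0 ≤ c₃)
    (hℓ₁ : 0 < ℓ₁) (hℓ₂ : 0 < ℓ₂) (hℓ₃ : 0 < ℓ₃) :
    volume (Rset c₁ c₂ c₃ ℓ₁ ℓ₂ ℓ₃) =
      ENNReal.ofReal (8 / 3 * ℓ₁ ^ 2 * ℓ₂ ^ 2 * (c₃ + ℓ₃)) := by
  set k := c₃ + ℓ₃ with hk
  have hk0 : 0 < k := by positivity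
  have h := volume_convexHull_simplex ![(c₁ - ℓ₁) * (c₂ - ℓ₂) * k, c₁ - ℓ₁, c₂ - ℓ₂]
    !![2 * ℓ₁ * (c₂ - ℓ₂) * k, 2 * ℓ₁, 0;
      2 * ℓ₂ * (c₁ - ℓ₁) * k, 0, 2 * ℓ₂;
      ((c₁ + ℓ₁) * (c₂ + ℓ₂) - (c₁ - ℓ₁) * (c₂ - ℓ₂)) * k, 2 * ℓ₁, 2 * ℓ₂]
  have hdet : |Matrix.det !![2 * ℓ₁ * (c₂ - ℓ₂) * k, 2 * ℓ₁, 0;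
      2 * ℓ₂ * (c₁ - ℓ₁) * k, 0, 2 * ℓ₂;
      ((c₁ + ℓ₁) * (c₂ + ℓ₂) - (c₁ - ℓ₁) * (c₂ - ℓ₂)) * k, 2 * ℓ₁, 2 * ℓ₂]| =
      16 * ℓ₁ ^ 2 * ℓ₂ ^ 2 * k := by
    rw [← abs_of_nonneg (show 0 ≤ 16 * ℓ₁ ^ 2 * ℓ₂ ^ 2 * k by positivity), Matrix.det_fin_three]
    congr 1
    simp
    ring
  rw [hdet] at h
  rw [Rset, ← hk]
  convert h using 2
  · have hrange (f : Fin 3 → Fin 3 → ℝ) {u v w : Fin 3 → ℝ} (hu : f 0 = u) (hv : f 1 = v)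
        (hw : f 2 = w) : Set.range f = {u, v, w} := by
      ext
      simp [Fin.exists_fin_succ, ← hu, ← hv, ← hw, eq_comm]
    refine congrArg _ (congrArg _ (hrange _ ?_ ?_ ?_).symm) <;>
      ext i <;> fin_cases i <;> simp <;> ring
  · norm_num [Nat.factorial]
    ring
end

section
/- Assume cᵢ ≥ 0 and ℓᵢ > 0 for i = 1,2,3 and the ordering condition (Ω′). Define N = (2ℓ₁ℓ₂/3)·Σᵢ₌₅⁸ sup{⟨x, uᵢ⟩ : x ∈ Q′} (this quantity equals the mixed volume V(Q′,R′,R′)). Then: N = (8/3)ℓ₁ℓ₂(c₃ℓ₁ℓ₂ + ℓ₃(2c₂ℓ₁ + c₁ℓ₂)) if c₁/ℓ₁ ≥ 1; N = (8/3)ℓ₁²ℓ₂(2c₂ℓ₃ + ℓ₂(c₃+ℓ₃)) if c₁/ℓ₁ < 1 and c₂/ℓ₂ ≥ 1; and N = (8/3)ℓ₁²ℓ₂²(c₃ + 3ℓ₃) if c₁/ℓ₁ < 1 and c₂/ℓ₂ < 1. -/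
open MeasureTheory

/-- The standard inner product on `ℝ³ = Fin 3 → ℝ`. -/
noncomputable def dot3 (u v : Fin 3 → ℝ) : ℝ := ∑ i, u i * v i

/-- A linear functional attains its supremum over a convex hull at a generating point. -/
theorem sSup_dot3_convexHull (S : Set (Fin 3 → ℝ)) (u p : Fin 3 → ℝ) (hp : p ∈ S)
    (h : ∀ x ∈ S, dot3 x u ≤ dot3 p u) :
    sSup {z : ℝ | ∃ x ∈ convexHull ℝ S, z = dot3 x u} = dot3 p u := by
  have hle : convexHull ℝ S ⊆ {x | dot3 x u ≤ dot3 p u} := by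
    refine convexHull_min h (convex_halfSpace_le ⟨fun x y => ?_, fun r x => ?_⟩ _)
    · simp only [dot3, Fin.sum_univ_three, Pi.add_apply]
      ring
    · simp only [dot3, Fin.sum_univ_three, Pi.smul_apply, smul_eq_mul]
      ring
  refine IsGreatest.csSup_eq ⟨⟨p, subset_convexHull ℝ S hp, rfl⟩, ?_⟩
  rintro z ⟨x, hx, rfl⟩
  exact hle hx

/-- The value of the functional `±(1, -(c₂ + p ℓ₂)(c₃ + ℓ₃), -(c₁ + q ℓ₁)(c₃ + ℓ₃))` (with sign `s`)
at the vertex of `Q'` with signs `i`, `j`, in units of `ℓ₁ ℓ₂ ℓ₃`, where `a`, `b`, `c` are the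
ratios `cᵢ / ℓᵢ`. -/
def vertexValue (a b c s p q i j : ℝ) : ℝ :=
  s * ((a + i) * (b + j) * (c - 1) - (c + 1) * ((a + i) * (b + p) + (b + j) * (a + q)))

/-- The value of the support function of `Q'` when the vertex with signs `i`, `j` maximises
`vertexValue`. -/
theorem sSup_dot3_Qset (a b c : ℝ) {l m n : ℝ} (hl : 0 < l) (hm : 0 < m) (hn : 0 < n)
    (s p q i j : ℝ) (hi : i = -1 ∨ i = 1) (hj : j = -1 ∨ j = 1)
    (h : vertexValue a b c s p q (-1) (-1) ≤ vertexValue a b c s p q i j ∧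
      vertexValue a b c s p q 1 (-1) ≤ vertexValue a b c s p q i j ∧
      vertexValue a b c s p q (-1) 1 ≤ vertexValue a b c s p q i j ∧
      vertexValue a b c s p q 1 1 ≤ vertexValue a b c s p q i j)
    (u : Fin 3 → ℝ)
    (hu : u = ![s, -s * ((b * m + p * m) * (c * n + n)), -s * ((a * l + q * l) * (c * n + n))]) :
    sSup {z : ℝ | ∃ x ∈ Qset (a * l) (b * m) (c * n) l m n, z = dot3 x u} =
      l * m * n * vertexValue a b c s p q i j := by
  have hval (i j : ℝ) : dot3 ![(a * l + i * l) * (b * m + j * m) * (c * n - n),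
      a * l + i * l, b * m + j * m] u = l * m * n * vertexValue a b c s p q i j := by
    simp [dot3, Fin.sum_univ_three, hu, vertexValue]
    ring
  have hS : Qset (a * l) (b * m) (c * n) l m n = convexHull ℝ
      {![(a * l + -1 * l) * (b * m + -1 * m) * (c * n - n), a * l + -1 * l, b * m + -1 * m],
       ![(a * l + 1 * l) * (b * m + -1 * m) * (c * n - n), a * l + 1 * l, b * m + -1 * m],
       ![(a * l + -1 * l) * (b * m + 1 * m) * (c * n - n), a * l + -1 * l, b * m + 1 * m],
       ![(a * l + 1 * l) * (b * m + 1 * m) * (c * n - n), a * l + 1 * l, b * m + 1 * m]} := by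
    simp only [Qset, neg_one_mul, one_mul, ← sub_eq_add_neg]
  rw [hS, ← hval i j]
  apply sSup_dot3_convexHull
  · rcases hi with rfl | rfl <;> rcases hj with rfl | rfl <;> simp
  · have hpos : 0 ≤ l * m * n := by positivity
    obtain ⟨h₁, h₂, h₃, h₄⟩ := h
    rintro x (rfl | rfl | rfl | rfl) <;> rw [hval, hval] <;>
      exact mul_le_mul_of_nonneg_left (by assumption) hpos

theorem mixed_volume_QRR (c₁ c₂ c₃ ℓ₁ ℓ₂ ℓ₃ : ℝ)
    (hc₁ : 0 ≤ c₁) (hc₂ : 0 ≤ c₂) (hc₃ : 0 ≤ c₃)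
    (hℓ₁ : 0 < ℓ₁) (hℓ₂ : 0 < ℓ₂) (hℓ₃ : 0 < ℓ₃)
    (hΩ₁ : c₁ / ℓ₁ ≤ c₂ / ℓ₂) (hΩ₂ : c₂ / ℓ₂ ≤ c₃ / ℓ₃)
    (u₅ u₆ u₇ u₈ : Fin 3 → ℝ)
    (hu₅ : u₅ = ![1, -((c₂ - ℓ₂) * (c₃ + ℓ₃)), -((c₁ + ℓ₁) * (c₃ + ℓ₃))])
    (hu₆ : u₆ = ![1, -((c₂ + ℓ₂) * (c₃ + ℓ₃)), -((c₁ - ℓ₁) * (c₃ + ℓ₃))])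
    (hu₇ : u₇ = ![-1, (c₂ + ℓ₂) * (c₃ + ℓ₃), (c₁ + ℓ₁) * (c₃ + ℓ₃)])
    (hu₈ : u₈ = ![-1, (c₂ - ℓ₂) * (c₃ + ℓ₃), (c₁ - ℓ₁) * (c₃ + ℓ₃)])
    (N : ℝ)
    (hN : N = 2 * ℓ₁ * ℓ₂ / 3 *
      (sSup {z : ℝ | ∃ x ∈ Qset c₁ c₂ c₃ ℓ₁ ℓ₂ ℓ₃, z = dot3 x u₅} +
       sSup {z : ℝ | ∃ x ∈ Qset c₁ c₂ c₃ ℓ₁ ℓ₂ ℓ₃, z = dot3 x u₆} +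
       sSup {z : ℝ | ∃ x ∈ Qset c₁ c₂ c₃ ℓ₁ ℓ₂ ℓ₃, z = dot3 x u₇} +
       sSup {z : ℝ | ∃ x ∈ Qset c₁ c₂ c₃ ℓ₁ ℓ₂ ℓ₃, z = dot3 x u₈})) :
    (1 ≤ c₁ / ℓ₁ →
      N = 8 / 3 * ℓ₁ * ℓ₂ * (c₃ * ℓ₁ * ℓ₂ + ℓ₃ * (2 * c₂ * ℓ₁ + c₁ * ℓ₂))) ∧
    (c₁ / ℓ₁ < 1 → 1 ≤ c₂ / ℓ₂ →
      N = 8 / 3 * ℓ₁ ^ 2 * ℓ₂ * (2 * c₂ * ℓ₃ + ℓ₂ * (c₃ + ℓ₃))) ∧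
    (c₁ / ℓ₁ < 1 → c₂ / ℓ₂ < 1 →
      N = 8 / 3 * ℓ₁ ^ 2 * ℓ₂ ^ 2 * (c₃ + 3 * ℓ₃)) := by
  obtain ⟨a, rfl⟩ : ∃ a, c₁ = a * ℓ₁ := ⟨c₁ / ℓ₁, by field_simp⟩
  obtain ⟨b, rfl⟩ : ∃ b, c₂ = b * ℓ₂ := ⟨c₂ / ℓ₂, by field_simp⟩
  obtain ⟨c, rfl⟩ : ∃ c, c₃ = c * ℓ₃ := ⟨c₃ / ℓ₃, by field_simp⟩
  rw [mul_div_cancel_right₀ _ hℓ₁.ne', mul_div_cancel_right₀ _ hℓ₂.ne'] at hΩ₁ ⊢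
  rw [mul_div_cancel_right₀ _ hℓ₂.ne', mul_div_cancel_right₀ _ hℓ₃.ne'] at hΩ₂
  have ha : 0 ≤ a := nonneg_of_mul_nonneg_left hc₁ hℓ₁
  have hb : 0 ≤ b := ha.trans hΩ₁
  have hc : 0 ≤ c := hb.trans hΩ₂
  have h₇ := sSup_dot3_Qset a b c hℓ₁ hℓ₂ hℓ₃ (-1) 1 1 1 1 (Or.inr rfl) (Or.inr rfl)
      (by refine ⟨?_, ?_, ?_, ?_⟩ <;> unfold vertexValue <;> linarith)
      u₇ (by rw [hu₇]; ring_nf)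
  refine ⟨fun h => ?_, fun h h' => ?_, fun h h' => ?_⟩
  · have hA : 0 ≤ a - 1 := by linarith
    have hB : 0 ≤ b - 1 := by linarith
    have hAc := mul_nonneg hA hc
    have hBc := mul_nonneg hB hc
    have h₅ := sSup_dot3_Qset a b c hℓ₁ hℓ₂ hℓ₃ 1 (-1) 1 (-1) (-1) (Or.inl rfl) (Or.inl rfl)
      (by refine ⟨?_, ?_, ?_, ?_⟩ <;> unfold vertexValue <;> linarith)
      u₅ (by rw [hu₅]; ring_nf)
    have h₆ := sSup_dot3_Qset a b c hℓ₁ hℓ₂ hℓ₃ 1 1 (-1) (-1) (-1) (Or.inl rfl) (Or.inl rfl)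
      (by refine ⟨?_, ?_, ?_, ?_⟩ <;> unfold vertexValue <;> linarith)
      u₆ (by rw [hu₆]; ring_nf)
    have h₈ := sSup_dot3_Qset a b c hℓ₁ hℓ₂ hℓ₃ (-1) (-1) (-1) 1 (-1) (Or.inr rfl) (Or.inl rfl)
      (by refine ⟨?_, ?_, ?_, ?_⟩ <;> unfold vertexValue <;> linarith)
      u₈ (by rw [hu₈]; ring_nf)
    rw [hN, h₅, h₆, h₇, h₈]
    unfold vertexValue
    ring
  · have hA : 0 ≤ 1 - a := by linarith
    have hB : 0 ≤ b - 1 := by linarith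
    have hAc := mul_nonneg hA hc
    have hBc := mul_nonneg hB hc
    have h₅ := sSup_dot3_Qset a b c hℓ₁ hℓ₂ hℓ₃ 1 (-1) 1 (-1) (-1) (Or.inl rfl) (Or.inl rfl)
      (by refine ⟨?_, ?_, ?_, ?_⟩ <;> unfold vertexValue <;> linarith)
      u₅ (by rw [hu₅]; ring_nf)
    have h₆ := sSup_dot3_Qset a b c hℓ₁ hℓ₂ hℓ₃ 1 1 (-1) (-1) 1 (Or.inl rfl) (Or.inr rfl)
      (by refine ⟨?_, ?_, ?_, ?_⟩ <;> unfold vertexValue <;> linarith)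
      u₆ (by rw [hu₆]; ring_nf)
    have h₈ := sSup_dot3_Qset a b c hℓ₁ hℓ₂ hℓ₃ (-1) (-1) (-1) 1 (-1) (Or.inr rfl) (Or.inl rfl)
      (by refine ⟨?_, ?_, ?_, ?_⟩ <;> unfold vertexValue <;> linarith)
      u₈ (by rw [hu₈]; ring_nf)
    rw [hN, h₅, h₆, h₇, h₈]
    unfold vertexValue
    ring
  · have hA : 0 ≤ 1 - a := by linarith
    have hB : 0 ≤ 1 - b := by linarith
    have hAc := mul_nonneg hA hc
    have hBc := mul_nonneg hB hc
    have h₅ := sSup_dot3_Qset a b c hℓ₁ hℓ₂ hℓ₃ 1 (-1) 1 1 (-1) (Or.inr rfl) (Or.inl rfl)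
      (by refine ⟨?_, ?_, ?_, ?_⟩ <;> unfold vertexValue <;> linarith)
      u₅ (by rw [hu₅]; ring_nf)
    have h₆ := sSup_dot3_Qset a b c hℓ₁ hℓ₂ hℓ₃ 1 1 (-1) (-1) 1 (Or.inl rfl) (Or.inr rfl)
      (by refine ⟨?_, ?_, ?_, ?_⟩ <;> unfold vertexValue <;> linarith)
      u₆ (by rw [hu₆]; ring_nf)
    have h₈ := sSup_dot3_Qset a b c hℓ₁ hℓ₂ hℓ₃ (-1) (-1) (-1) (-1) (-1) (Or.inl rfl) (Or.inl rfl)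
      (by refine ⟨?_, ?_, ?_, ?_⟩ <;> unfold vertexValue <;> linarith)
      u₈ (by rw [hu₈]; ring_nf)
    rw [hN, h₅, h₆, h₇, h₈]
    unfold vertexValue
    ring
end
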